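/- (Integrality gap of the substructure, key step of Proposition 4.) Assume f_s ≥ 0 componentwise for every stage s and λ_s ∈ [0,1] for s = 2,…,T. Let ŷ : 𝒯 → ℝ^J and û : 𝒯∖{r} → ℝ be given with b_n := B_{τ(n)} ŷ_n ≥ 0 componentwise for every node n. Let Q^M(ŷ,û) be the optimal value of SP-RMS(ŷ,û) and Q^MLP(ŷ,û) the optimal value of its LP relaxation (x : 𝒯 → ℝ^M, x_n ≥ 0, same constraints and objective). Then Q^M(ŷ,û) − Q^MLP(ŷ,û) ≤ ∑_{s=1}^T ∑_{i=1}^M f_{s,i}. -/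

import Mathlib

open Finset

/-- A scenario tree with `T` stages: a finite nonempty set of nodes with a root,
a parent map fixing the root, a stage map decreasing by one along the parent map,
such that every node reaches the root by iterating the parent map, and every
non-leaf node has a child. -/
structure STree (T : ℕ) : Type 1 where
  Node : Type
  fin : Fintype Node
  deceq : DecidableEq Node
  root : Node
  parent : Node → Node
  stage : Node → ℕ
  hT : 1 ≤ T
  parent_root : parent root = root
  stage_root : stage root = 1
  stage_ge : ∀ n, 1 ≤ stage n
  stage_le : ∀ n, stage n ≤ T
  stage_parent : ∀ n, n ≠ root → stage (parent n) = stage n - 1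
  reaches_root : ∀ n, ∃ k, parent^[k] n = root
  children_ne : ∀ n, stage n ≠ T → ∃ m, m ≠ root ∧ parent m = n

attribute [instance] STree.fin STree.deceq

namespace STree

variable {T : ℕ} (S : STree T)

/-- The path set `𝒫(n) = {aᵏ(n) : k ≥ 0}` of a node. -/
def path (n : S.Node) : Finset S.Node :=
  (Finset.range T).image fun k => S.parent^[k] n

theorem path_nonempty (n : S.Node) : (S.path n).Nonempty :=
  ⟨n, Finset.mem_image.mpr ⟨0, Finset.mem_range.mpr S.hT, rfl⟩⟩

/-- The children `𝒞(n)` of a node. -/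
def children (n : S.Node) : Finset S.Node :=
  Finset.univ.filter fun m => m ≠ S.root ∧ S.parent m = n

theorem children_nonempty {n : S.Node} (h : S.stage n ≠ T) : (S.children n).Nonempty := by
  obtain ⟨m, h1, h2⟩ := S.children_ne n h
  exact ⟨m, Finset.mem_filter.mpr ⟨Finset.mem_univ m, h1, h2⟩⟩

/-- The set `𝒯ₛ` of stage-`s` nodes. -/
def stageNodes (s : ℕ) : Finset S.Node :=
  Finset.univ.filter fun n => S.stage n = s

theorem stageNodes_self_nonempty (n : S.Node) : (S.stageNodes (S.stage n)).Nonempty :=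
  ⟨n, Finset.mem_filter.mpr ⟨Finset.mem_univ n, rfl⟩⟩

end STree

section Constructions

variable {T M J : ℕ}

/-- `b_n = B_{τ(n)} ŷ_n` (componentwise). -/
noncomputable def bvec (S : STree T) (B : ℕ → Matrix (Fin M) (Fin J) ℝ)
    (yh : S.Node → Fin J → ℝ) (n : S.Node) (i : Fin M) : ℝ :=
  (B (S.stage n)).mulVec (yh n) i

/-- Componentwise maximum of `b` over all nodes of the same stage as `n`
(used for `b̄_n = max_{l ∈ 𝒯_{τ(n)}} b_l`). -/
noncomputable def stageMax (S : STree T) (b : S.Node → Fin M → ℝ) (n : S.Node) (i : Fin M) : ℝ :=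
  (S.stageNodes (S.stage n)).sup' (S.stageNodes_self_nonempty n) fun l => b l i

/-- `max_{m ∈ 𝒫(n)} ⌈b_m⌉` (componentwise). -/
noncomputable def pmc (S : STree T) (b : S.Node → Fin M → ℝ) (n : S.Node) (i : Fin M) : ℤ :=
  (S.path n).sup' (S.path_nonempty n) fun m => ⌈b m i⌉

/-- `max_{m ∈ 𝒫(n)} b_m` (componentwise, no rounding). -/
noncomputable def pm (S : STree T) (b : S.Node → Fin M → ℝ) (n : S.Node) (i : Fin M) : ℝ :=
  (S.path n).sup' (S.path_nonempty n) fun m => b m i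

end Constructions

section Substructure

variable {T M J : ℕ}

/-- Feasibility for the substructure problem SP-RMS(ŷ,û). -/
def FeasSP (S : STree T) (f : ℕ → Fin M → ℝ) (c : ℕ → Fin J → ℝ)
    (B : ℕ → Matrix (Fin M) (Fin J) ℝ)
    (yh : S.Node → Fin J → ℝ) (uh : S.Node → ℝ)
    (x : S.Node → Fin M → ℤ) (η : S.Node → ℝ) : Prop :=
  (∀ n i, 0 ≤ x n i) ∧
  (∀ n i, (B (S.stage n)).mulVec (yh n) i ≤ ∑ m ∈ S.path n, (x m i : ℝ)) ∧
  ∀ n, n ≠ S.root →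
    (∑ i, f (S.stage n) i * ∑ m ∈ S.path n, (x m i : ℝ))
      + (∑ j, c (S.stage n) j * yh n j) - uh n ≤ η (S.parent n)

/-- Objective `G(x,η) = ∑_n p_n ( f̃_n · ∑_{m∈𝒫(n)} x_m + λ̃_n η_n )` of the
substructure problem, where `f̃` and `λ̃` are the derived coefficients. -/
noncomputable def Gobj (S : STree T) (p : S.Node → ℝ) (f : ℕ → Fin M → ℝ) (lam : ℕ → ℝ)
    (x : S.Node → Fin M → ℤ) (η : S.Node → ℝ) : ℝ :=
  ∑ n, p n *
    ((∑ i, (if n = S.root then f 1 i else (1 - lam (S.stage n)) * f (S.stage n) i)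
        * ∑ m ∈ S.path n, (x m i : ℝ))
     + (if S.stage n = T then 0 else lam (S.stage n + 1)) * η n)

end Substructure

section SubstructureLP

variable {T M J : ℕ}

/-- Feasibility for the LP relaxation of SP-RMS(ŷ,û) (fractional capacities). -/
def FeasSPR (S : STree T) (f : ℕ → Fin M → ℝ) (c : ℕ → Fin J → ℝ)
    (B : ℕ → Matrix (Fin M) (Fin J) ℝ)
    (yh : S.Node → Fin J → ℝ) (uh : S.Node → ℝ)
    (x : S.Node → Fin M → ℝ) (η : S.Node → ℝ) : Prop :=
  (∀ n i, 0 ≤ x n i) ∧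
  (∀ n i, (B (S.stage n)).mulVec (yh n) i ≤ ∑ m ∈ S.path n, x m i) ∧
  ∀ n, n ≠ S.root →
    (∑ i, f (S.stage n) i * ∑ m ∈ S.path n, x m i)
      + (∑ j, c (S.stage n) j * yh n j) - uh n ≤ η (S.parent n)

/-- Objective of the LP relaxation of the substructure problem. -/
noncomputable def GobjR (S : STree T) (p : S.Node → ℝ) (f : ℕ → Fin M → ℝ) (lam : ℕ → ℝ)
    (x : S.Node → Fin M → ℝ) (η : S.Node → ℝ) : ℝ :=
  ∑ n, p n *
    ((∑ i, (if n = S.root then f 1 i else (1 - lam (S.stage n)) * f (S.stage n) i)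
        * ∑ m ∈ S.path n, x m i)
     + (if S.stage n = T then 0 else lam (S.stage n + 1)) * η n)

end SubstructureLP

namespace STree

variable {T : ℕ} (S : STree T)

theorem path_induction {P : S.Node → Prop} (hroot : P S.root)
    (hstep : ∀ n, n ≠ S.root → P (S.parent n) → P n) (n : S.Node) : P n := by
  obtain ⟨k, hk⟩ := S.reaches_root n
  induction k generalizing n with
  | zero => exact (show n = S.root from hk) ▸ hroot
  | succ k ih =>
    by_cases hn : n = S.root
    · exact hn ▸ hroot
    · exact hstep n hn (ih _ (by simpa [Function.iterate_succ_apply] using hk))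

theorem stage_eq_one_iff (n : S.Node) : S.stage n = 1 ↔ n = S.root := by
  refine ⟨fun h => ?_, fun h => h ▸ S.stage_root⟩
  by_contra hn
  have h1 := S.stage_parent n hn
  have h2 := S.stage_ge (S.parent n)
  omega

theorem stage_eq_stage_parent_add_one {n : S.Node} (hn : n ≠ S.root) :
    S.stage n = S.stage (S.parent n) + 1 := by
  have h1 := S.stage_parent n hn
  have h2 := S.stage_ge n
  omega

theorem iterate_parent_root (k : ℕ) : S.parent^[k] S.root = S.root :=
  Function.iterate_fixed S.parent_root k

theorem iterate_parent_stage_sub_one (n : S.Node) : S.parent^[S.stage n - 1] n = S.root := by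
  induction n using S.path_induction with
  | hroot => exact S.iterate_parent_root _
  | hstep n hn ih =>
    have h1 := S.stage_eq_stage_parent_add_one hn
    have h2 := S.stage_ge (S.parent n)
    have h3 : S.stage n - 1 = (S.stage (S.parent n) - 1) + 1 := by omega
    rw [h3, Function.iterate_succ_apply, ih]

theorem mem_path {n m : S.Node} : m ∈ S.path n ↔ ∃ k, S.parent^[k] n = m := by
  simp only [path, mem_image, mem_range]
  refine ⟨fun ⟨k, _, hk⟩ => ⟨k, hk⟩, fun ⟨k, hk⟩ => ?_⟩
  have h1 := S.stage_ge n
  have h2 := S.stage_le n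
  by_cases hkT : k < T
  · exact ⟨k, hkT, hk⟩
  · refine ⟨S.stage n - 1, by omega, ?_⟩
    have h3 : k = (k - (S.stage n - 1)) + (S.stage n - 1) := by omega
    rw [← hk, h3, Function.iterate_add_apply, S.iterate_parent_stage_sub_one,
      S.iterate_parent_root]

theorem self_mem_path (n : S.Node) : n ∈ S.path n :=
  S.mem_path.2 ⟨0, rfl⟩

theorem path_root : S.path S.root = {S.root} := by
  ext m
  simp [mem_path, iterate_parent_root, eq_comm]

theorem path_eq_insert (n : S.Node) : S.path n = insert n (S.path (S.parent n)) := by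
  ext m
  rw [mem_insert, mem_path, mem_path]
  constructor
  · rintro ⟨_ | k, hk⟩
    · exact Or.inl hk.symm
    · exact Or.inr ⟨k, hk⟩
  · rintro (rfl | ⟨k, hk⟩)
    · exact ⟨0, rfl⟩
    · exact ⟨k + 1, hk⟩

theorem stage_le_of_mem_path {n m : S.Node} (h : m ∈ S.path n) : S.stage m ≤ S.stage n := by
  induction n using S.path_induction with
  | hroot => simp_all [path_root]
  | hstep n hn ih =>
    rw [path_eq_insert, mem_insert] at h
    have h1 := S.stage_eq_stage_parent_add_one hn
    rcases h with rfl | h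
    · exact le_rfl
    · have := ih h
      omega

theorem notMem_path_parent {n : S.Node} (hn : n ≠ S.root) : n ∉ S.path (S.parent n) := fun h => by
  have h1 := S.stage_le_of_mem_path h
  have h2 := S.stage_eq_stage_parent_add_one hn
  omega

theorem sum_path_of_ne_root {R : Type*} [AddCommMonoid R] (x : S.Node → R) {n : S.Node}
    (hn : n ≠ S.root) : ∑ m ∈ S.path n, x m = x n + ∑ m ∈ S.path (S.parent n), x m := by
  rw [S.path_eq_insert n, sum_insert (S.notMem_path_parent hn)]

/-- The increments of `Z` along the tree. -/
def increment (Z : S.Node → ℤ) (n : S.Node) : ℤ :=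
  if n = S.root then Z n else Z n - Z (S.parent n)

theorem sum_path_increment (Z : S.Node → ℤ) (n : S.Node) :
    ∑ m ∈ S.path n, S.increment Z m = Z n := by
  induction n using S.path_induction with
  | hroot => simp [path_root, increment]
  | hstep n hn ih => rw [S.sum_path_of_ne_root _ hn, ih]; simp [increment, hn]

theorem sum_mul_stage (p : S.Node → ℝ)
    (hp1 : ∀ s, 1 ≤ s → s ≤ T → ∑ n ∈ S.stageNodes s, p n = 1) (h : ℕ → ℝ) :
    ∑ n, p n * h (S.stage n) = ∑ s ∈ Icc 1 T, h s := by
  rw [← sum_fiberwise_of_maps_to (g := S.stage) (t := Icc 1 T)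
    fun n _ => mem_Icc.2 ⟨S.stage_ge n, S.stage_le n⟩]
  refine sum_congr rfl fun s hs => ?_
  rw [mem_Icc] at hs
  calc _ = ∑ n ∈ S.stageNodes s, p n * h s :=
        sum_congr rfl fun n hn => by rw [(mem_filter.1 hn).2]
    _ = h s := by rw [← sum_mul, hp1 s hs.1 hs.2, one_mul]

end STree

theorem sum_risk_weights {T : ℕ} (hT : 1 ≤ T) (lam F : ℕ → ℝ) :
    ∑ s ∈ Icc 1 T, ((if s = 1 then F 1 else (1 - lam s) * F s)
      + (if s = T then 0 else lam (s + 1)) * F (s + 1)) = ∑ s ∈ Icc 1 T, F s := by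
  have key : ∑ s ∈ Icc 1 T, (if s = 1 then F 1 else (1 - lam s) * F s)
      + ∑ s ∈ Ico 1 T, lam (s + 1) * F (s + 1) = ∑ s ∈ Icc 1 T, F s := by
    induction T, hT using Nat.le_induction with
    | base => simp
    | succ t ht ih =>
      rw [sum_Icc_succ_top (by omega), sum_Icc_succ_top (by omega), sum_Ico_succ_top ht, ← ih,
        if_neg (by omega)]
      ring
  rw [← key, sum_add_distrib, ← Ico_insert_right hT, sum_insert (by simp),
    sum_insert (by simp)]
  congr 1
  rw [if_pos rfl, zero_mul, zero_add]
  exact sum_congr rfl fun s hs => by rw [if_neg (mem_Ico.1 hs).2.ne]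

section Gap

variable {T M J : ℕ} (S : STree T) {p : S.Node → ℝ} {f : ℕ → Fin M → ℝ} {c : ℕ → Fin J → ℝ}
  {B : ℕ → Matrix (Fin M) (Fin J) ℝ} {lam : ℕ → ℝ} {yh : S.Node → Fin J → ℝ} {uh : S.Node → ℝ}

theorem cost_coeff_nonneg (hf : ∀ s, 1 ≤ s → s ≤ T → ∀ i, 0 ≤ f s i)
    (hlam : ∀ s, 2 ≤ s → s ≤ T → 0 ≤ lam s ∧ lam s ≤ 1) (n : S.Node) (i : Fin M) :
    0 ≤ if n = S.root then f 1 i else (1 - lam (S.stage n)) * f (S.stage n) i := by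
  have h1 := S.stage_ge n
  have h2 := S.stage_le n
  split_ifs with h
  · exact hf 1 le_rfl S.hT i
  · have h3 := mt (S.stage_eq_one_iff n).1 h
    exact mul_nonneg (sub_nonneg.2 (hlam _ (by omega) h2).2) (hf _ h1 h2 i)

theorem risk_coeff_nonneg (hlam : ∀ s, 2 ≤ s → s ≤ T → 0 ≤ lam s ∧ lam s ≤ 1) (n : S.Node) :
    0 ≤ if S.stage n = T then 0 else lam (S.stage n + 1) := by
  have h1 := S.stage_ge n
  have h2 := S.stage_le n
  split_ifs with h
  · exact le_rfl
  · exact (hlam _ (by omega) (by omega)).1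

theorem FeasSPR.exists_of_bvec_nonneg (hb : ∀ n i, 0 ≤ bvec S B yh n i) :
    ∃ x η, FeasSPR S f c B yh uh x η := by
  let g : S.Node → ℝ := fun n => (∑ i, f (S.stage n) i * ∑ m ∈ S.path n, bvec S B yh m i)
      + (∑ j, c (S.stage n) j * yh n j) - uh n
  refine ⟨bvec S B yh, fun _ => ∑ m, |g m|, hb, fun n i => ?_, fun n _ => ?_⟩
  · exact single_le_sum (f := fun m => bvec S B yh m i) (fun m _ => hb m i) (S.self_mem_path n)
  · exact (le_abs_self (g n)).trans
      (single_le_sum (f := fun m => |g m|) (fun m _ => abs_nonneg _) (mem_univ n))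

theorem bddBelow_Gobj (hp : ∀ n, 0 ≤ p n) (hf : ∀ s, 1 ≤ s → s ≤ T → ∀ i, 0 ≤ f s i)
    (hlam : ∀ s, 2 ≤ s → s ≤ T → 0 ≤ lam s ∧ lam s ≤ 1) :
    BddBelow {v : ℝ | ∃ x η, FeasSP S f c B yh uh x η ∧ v = Gobj S p f lam x η} := by
  have hlow : ∀ n, ∃ L : ℝ, ∀ x η, FeasSP S f c B yh uh x η → S.stage n ≠ T → L ≤ η n := by
    intro n
    by_cases hn : S.stage n = T
    · exact ⟨0, fun _ _ _ h => absurd hn h⟩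
    obtain ⟨m, hm, rfl⟩ := S.children_ne n hn
    refine ⟨(∑ j, c (S.stage m) j * yh m j) - uh m, fun x η h _ => ?_⟩
    have h1 := h.2.2 m hm
    have h2 : 0 ≤ ∑ i, f (S.stage m) i * ∑ l ∈ S.path m, (x l i : ℝ) :=
      sum_nonneg fun i _ => mul_nonneg (hf _ (S.stage_ge m) (S.stage_le m) i)
        (sum_nonneg fun l _ => by exact_mod_cast h.1 l i)
    linarith
  choose L hL using hlow
  refine ⟨∑ n, p n * ((if S.stage n = T then 0 else lam (S.stage n + 1)) * L n), ?_⟩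
  rintro _ ⟨x, η, h, rfl⟩
  refine sum_le_sum fun n _ => mul_le_mul_of_nonneg_left ?_ (hp n)
  have h1 : 0 ≤ ∑ i, (if n = S.root then f 1 i else (1 - lam (S.stage n)) * f (S.stage n) i)
        * ∑ m ∈ S.path n, (x m i : ℝ) :=
    sum_nonneg fun i _ => mul_nonneg (cost_coeff_nonneg S hf hlam n i)
      (sum_nonneg fun l _ => by exact_mod_cast h.1 l i)
  have h2 : (if S.stage n = T then 0 else lam (S.stage n + 1)) * L n
      ≤ (if S.stage n = T then 0 else lam (S.stage n + 1)) * η n := by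
    by_cases hn : S.stage n = T
    · simp [hn]
    · exact mul_le_mul_of_nonneg_left (hL n x η h hn) (risk_coeff_nonneg S hlam n)
  linarith

/-- Rounding up the cumulative capacities of a fractional solution. -/
noncomputable def ceilSol (x : S.Node → Fin M → ℝ) (n : S.Node) (i : Fin M) : ℤ :=
  S.increment (fun m => ⌈∑ l ∈ S.path m, x l i⌉) n

theorem sum_path_ceilSol (x : S.Node → Fin M → ℝ) (n : S.Node) (i : Fin M) :
    ∑ m ∈ S.path n, (ceilSol S x m i : ℝ) = ⌈∑ m ∈ S.path n, x m i⌉ := by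
  exact_mod_cast S.sum_path_increment (fun m => ⌈∑ l ∈ S.path m, x l i⌉) n

theorem FeasSPR.feasSP_ceilSol (hf : ∀ s, 1 ≤ s → s ≤ T → ∀ i, 0 ≤ f s i)
    {x : S.Node → Fin M → ℝ} {η : S.Node → ℝ} (h : FeasSPR S f c B yh uh x η) :
    FeasSP S f c B yh uh (ceilSol S x) (fun n => η n + ∑ i, f (S.stage n + 1) i) := by
  refine ⟨fun n i => ?_, fun n i => ?_, fun n hn => ?_⟩
  · unfold ceilSol STree.increment
    split_ifs with hn
    · exact Int.ceil_nonneg (sum_nonneg fun m _ => h.1 m i)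
    · refine sub_nonneg.2 (Int.ceil_mono ?_)
      rw [S.sum_path_of_ne_root _ hn]
      exact le_add_of_nonneg_left (h.1 n i)
  · rw [sum_path_ceilSol]
    exact (h.2.1 n i).trans (Int.le_ceil _)
  · have h1 := h.2.2 n hn
    have h2 : ∑ i, f (S.stage n) i * ∑ m ∈ S.path n, (ceilSol S x m i : ℝ)
        ≤ (∑ i, f (S.stage n) i * ∑ m ∈ S.path n, x m i) + ∑ i, f (S.stage n) i := by
      rw [← sum_add_distrib]
      refine sum_le_sum fun i _ => ?_
      rw [sum_path_ceilSol, ← mul_add_one]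
      exact mul_le_mul_of_nonneg_left (Int.ceil_lt_add_one _).le
        (hf _ (S.stage_ge n) (S.stage_le n) i)
    beta_reduce
    rw [← S.stage_eq_stage_parent_add_one hn]
    linarith

theorem Gobj_ceilSol_le (hp : ∀ n, 0 ≤ p n)
    (hp1 : ∀ s, 1 ≤ s → s ≤ T → ∑ n ∈ S.stageNodes s, p n = 1)
    (hf : ∀ s, 1 ≤ s → s ≤ T → ∀ i, 0 ≤ f s i)
    (hlam : ∀ s, 2 ≤ s → s ≤ T → 0 ≤ lam s ∧ lam s ≤ 1)
    (x : S.Node → Fin M → ℝ) (η : S.Node → ℝ) :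
    Gobj S p f lam (ceilSol S x) (fun n => η n + ∑ i, f (S.stage n + 1) i)
      ≤ GobjR S p f lam x η + ∑ s ∈ Icc 1 T, ∑ i, f s i := by
  rw [← sum_risk_weights S.hT lam fun s => ∑ i, f s i, ← S.sum_mul_stage p hp1, Gobj, GobjR,
    ← sum_add_distrib]
  refine sum_le_sum fun n _ => ?_
  rw [← mul_add]
  refine mul_le_mul_of_nonneg_left ?_ (hp n)
  have h1 : ∑ i, (if n = S.root then f 1 i else (1 - lam (S.stage n)) * f (S.stage n) i)
        * ∑ m ∈ S.path n, (ceilSol S x m i : ℝ)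
      ≤ ∑ i, (if n = S.root then f 1 i else (1 - lam (S.stage n)) * f (S.stage n) i)
        * ∑ m ∈ S.path n, x m i
      + ∑ i, (if n = S.root then f 1 i else (1 - lam (S.stage n)) * f (S.stage n) i) := by
    rw [← sum_add_distrib]
    refine sum_le_sum fun i _ => ?_
    rw [sum_path_ceilSol, ← mul_add_one]
    exact mul_le_mul_of_nonneg_left (Int.ceil_lt_add_one _).le (cost_coeff_nonneg S hf hlam n i)
  have h2 : ∑ i, (if n = S.root then f 1 i else (1 - lam (S.stage n)) * f (S.stage n) i)
      = if S.stage n = 1 then ∑ i, f 1 i else (1 - lam (S.stage n)) * ∑ i, f (S.stage n) i := by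
    simp only [S.stage_eq_one_iff]
    split_ifs
    · rfl
    · rw [mul_sum]
  rw [mul_add]
  linarith

end Gap

/-- integrality gap of the substructure, key step of Proposition 4:
the optimal value of SP-RMS(ŷ,û) exceeds that of its LP relaxation by at most
`∑_{s=1}^T ∑_{i=1}^M f_{s,i}`. -/
theorem substructure_integrality_gap {T M J : ℕ} (S : STree T)
    (p : S.Node → ℝ) (f : ℕ → Fin M → ℝ) (c : ℕ → Fin J → ℝ)
    (B : ℕ → Matrix (Fin M) (Fin J) ℝ) (lam : ℕ → ℝ)
    (hp : ∀ n, 0 ≤ p n)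
    (hp1 : ∀ s, 1 ≤ s → s ≤ T → ∑ n ∈ S.stageNodes s, p n = 1)
    (hpc : ∀ n, S.stage n ≠ T → ∑ m ∈ S.children n, p m = p n)
    (hf : ∀ s, 1 ≤ s → s ≤ T → ∀ i, 0 ≤ f s i)
    (hlam : ∀ s, 2 ≤ s → s ≤ T → 0 ≤ lam s ∧ lam s ≤ 1)
    (yh : S.Node → Fin J → ℝ) (uh : S.Node → ℝ)
    (hb : ∀ n i, 0 ≤ bvec S B yh n i) :
    sInf {v : ℝ | ∃ x η, FeasSP S f c B yh uh x η ∧ v = Gobj S p f lam x η}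
      - sInf {v : ℝ | ∃ x η, FeasSPR S f c B yh uh x η ∧ v = GobjR S p f lam x η}
      ≤ ∑ s ∈ Finset.Icc 1 T, ∑ i, f s i := by
  rw [sub_le_iff_le_add', ← sub_le_iff_le_add]
  obtain ⟨x₀, η₀, h₀⟩ := FeasSPR.exists_of_bvec_nonneg S (f := f) (c := c) (uh := uh) hb
  refine le_csInf ⟨_, x₀, η₀, h₀, rfl⟩ ?_
  rintro _ ⟨x, η, h, rfl⟩
  rw [sub_le_iff_le_add]
  exact (csInf_le (bddBelow_Gobj S hp hf hlam) ⟨_, _, h.feasSP_ceilSol S hf, rfl⟩).trans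
    (Gobj_ceilSol_le S hp hp1 hf hlam x η)
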